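/- arXiv:1001.1007 — 4 statements merged into one kernel-verified Lean document; each statement's English description precedes it below -/
import Mathlib

section
/- Let d ≥ 1 and let λ, a_1, …, a_d be real numbers. Let M_λ be the d×d matrix with zero diagonal entries and off-diagonal entries (M_λ)_{ij} = λ a_j for i ≠ j, and let I be the d×d identity matrix. Then det(M_λ − I) = (−1)^d · [ 1 − Σ_{ℓ=2}^{d} (ℓ−1) λ^ℓ Σ_{S ⊆ {1,…,d}, |S| = ℓ} Π_{i ∈ S} a_i ]. -/
open Finset

noncomputable section

/-- The matrix `M_λ` with zero diagonal and off-diagonal entries `(M_λ)_{ij} = λ a_j`. -/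
def hamM (d : ℕ) (a : Fin d → ℝ) (lam : ℝ) : Matrix (Fin d) (Fin d) ℝ :=
  Matrix.of fun i j => if i = j then 0 else lam * a j

lemma det_diagonal_add_replicateCol_mul_replicateRow_of_ne_zero {n K : Type*} [Fintype n]
    [DecidableEq n] [Field K] (c u v : n → K) (hc : ∀ i, c i ≠ 0) :
    (Matrix.diagonal c + Matrix.replicateCol Unit u * Matrix.replicateRow Unit v).det =
      ∏ i, c i + ∑ i, u i * v i * ∏ j ∈ univ.erase i, c j := by
  have hdet : IsUnit (Matrix.diagonal c).det := by
    simpa [Matrix.det_diagonal, Finset.prod_eq_zero_iff] using hc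
  have hinv : (Matrix.diagonal c)⁻¹ = Matrix.diagonal fun i => (c i)⁻¹ := by
    refine Matrix.inv_eq_right_inv ?_
    simp [Matrix.diagonal_mul_diagonal, hc]
  rw [Matrix.det_add_replicateCol_mul_replicateRow hdet, hinv, Matrix.det_diagonal,
    Matrix.det_unique, Matrix.add_apply, Matrix.one_apply_eq, Matrix.mul_apply]
  simp only [Matrix.mul_diagonal, Matrix.replicateRow_apply, Matrix.replicateCol_apply, mul_add,
    mul_one, Finset.mul_sum]
  congr 1
  refine Finset.sum_congr rfl fun i _ => ?_
  rw [← Finset.mul_prod_erase univ c (mem_univ i)]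
  have := hc i
  field_simp

lemma det_diagonal_add_replicateCol_mul_replicateRow {n : Type*} [Fintype n] [DecidableEq n]
    (c u v : n → ℝ) :
    (Matrix.diagonal c + Matrix.replicateCol Unit u * Matrix.replicateRow Unit v).det =
      ∏ i, c i + ∑ i, u i * v i * ∏ j ∈ univ.erase i, c j := by
  let L : ℝ → ℝ := fun t =>
    (Matrix.diagonal (fun i => c i + t) +
      Matrix.replicateCol Unit u * Matrix.replicateRow Unit v).det
  let R : ℝ → ℝ := fun t =>
    ∏ i, (c i + t) + ∑ i, u i * v i * ∏ j ∈ univ.erase i, (c j + t)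
  have hL : Continuous L := by
    refine Continuous.matrix_det (Continuous.add (Continuous.matrix_diagonal ?_) continuous_const)
    fun_prop
  have hR : Continuous R := by fun_prop
  have hLR : L = R := by
    refine hL.ext_on ((Set.countable_range fun i => -c i).dense_compl ℝ) hR fun t ht => ?_
    refine det_diagonal_add_replicateCol_mul_replicateRow_of_ne_zero _ u v fun i hi => ht ⟨i, ?_⟩
    simp only
    linarith
  simpa [L, R] using congrFun hLR 0

lemma sum_mul_prod_erase_one_add {ι R : Type*} [DecidableEq ι] [CommRing R] (b : ι → R)
    (s : Finset ι) :
    ∑ i ∈ s, b i * ∏ j ∈ s.erase i, (1 + b j) =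
      ∑ t ∈ s.powerset, (#t : R) * ∏ i ∈ t, b i := by
  induction s using Finset.induction_on with
  | empty => simp
  | insert a s ha ih =>
    have hleft : ∑ i ∈ s, b i * ∏ j ∈ (insert a s).erase i, (1 + b j) =
        (1 + b a) * ∑ i ∈ s, b i * ∏ j ∈ s.erase i, (1 + b j) := by
      rw [Finset.mul_sum]
      refine Finset.sum_congr rfl fun i hi => ?_
      have hai : a ≠ i := fun h => ha (h ▸ hi)
      rw [Finset.erase_insert_of_ne hai,
        Finset.prod_insert fun h => ha (Finset.mem_of_mem_erase h)]
      ring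
    have hright : ∑ t ∈ s.powerset, (#(insert a t) : R) * ∏ i ∈ insert a t, b i =
        b a * ∑ t ∈ s.powerset, (#t : R) * ∏ i ∈ t, b i +
          b a * ∑ t ∈ s.powerset, ∏ i ∈ t, b i := by
      rw [Finset.mul_sum, Finset.mul_sum, ← Finset.sum_add_distrib]
      refine Finset.sum_congr rfl fun t ht => ?_
      have hat : a ∉ t := Finset.notMem_mono (Finset.mem_powerset.1 ht) ha
      rw [Finset.card_insert_of_notMem hat, Finset.prod_insert hat]
      push_cast
      ring
    rw [Finset.sum_insert ha, Finset.erase_insert ha, hleft, Finset.sum_powerset_insert ha,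
      hright, ih, Finset.prod_one_add]
    ring

lemma prod_one_add_sub_sum_mul_prod_erase {ι R : Type*} [DecidableEq ι] [CommRing R] (b : ι → R)
    (s : Finset ι) :
    ∏ i ∈ s, (1 + b i) - ∑ i ∈ s, b i * ∏ j ∈ s.erase i, (1 + b j) =
      1 - ∑ l ∈ Finset.Icc 2 #s, ((l : R) - 1) * ∑ t ∈ Finset.powersetCard l s, ∏ i ∈ t, b i := by
  have hsum : ∏ i ∈ s, (1 + b i) - ∑ i ∈ s, b i * ∏ j ∈ s.erase i, (1 + b j) =
      ∑ l ∈ Finset.range (#s + 1),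
        (1 - (l : R)) * ∑ t ∈ Finset.powersetCard l s, ∏ i ∈ t, b i := by
    rw [sum_mul_prod_erase_one_add, Finset.prod_one_add, ← Finset.sum_sub_distrib,
      Finset.sum_powerset]
    refine Finset.sum_congr rfl fun l _ => ?_
    rw [Finset.mul_sum]
    refine Finset.sum_congr rfl fun t ht => ?_
    rw [(Finset.mem_powersetCard.1 ht).2]
    ring
  have hsub : Finset.Icc 2 #s ⊆ (Finset.range (#s + 1)).erase 0 := by
    intro l
    simp only [Finset.mem_Icc, Finset.mem_erase, Finset.mem_range]
    omega
  rw [hsum, ← Finset.add_sum_erase _ _ (Finset.mem_range.2 (Nat.succ_pos #s)),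
    ← Finset.sum_subset hsub, sub_eq_add_neg (1 : R) (∑ _ ∈ _, _), ← Finset.sum_neg_distrib]
  · simp [← neg_mul]
  · intro l hl hl'
    obtain rfl : l = 1 := by
      simp only [Finset.mem_Icc, Finset.mem_erase, Finset.mem_range] at hl hl'
      omega
    simp

lemma hamM_sub_one_eq_neg (d : ℕ) (a : Fin d → ℝ) (lam : ℝ) :
    hamM d a lam - 1 = -(Matrix.diagonal (fun i => 1 + lam * a i) +
      Matrix.replicateCol Unit (fun _ => (-1 : ℝ)) *
        Matrix.replicateRow Unit fun i => lam * a i) := by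
  ext i j
  by_cases h : i = j
  · subst h
    simp [hamM, Matrix.mul_apply]
  · simp [hamM, Matrix.mul_apply, h]

/-- Lemma 1.3 of the paper:
`det(M_λ − I) = (−1)^d [1 − Σ_{ℓ=2}^d (ℓ−1) λ^ℓ Σ_{|S|=ℓ} Π_{i∈S} a_i]`. -/
theorem det_hamM_sub_one (d : ℕ) (hd : 1 ≤ d) (lam : ℝ) (a : Fin d → ℝ) :
    (hamM d a lam - 1).det =
      (-1 : ℝ) ^ d *
        (1 - ∑ ℓ ∈ Finset.Icc 2 d, ((ℓ : ℝ) - 1) * lam ^ ℓ *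
              ∑ S ∈ Finset.powersetCard ℓ (Finset.univ : Finset (Fin d)),
                ∏ i ∈ S, a i) := by
  have key := prod_one_add_sub_sum_mul_prod_erase (fun i => lam * a i) univ
  rw [hamM_sub_one_eq_neg, Matrix.det_neg, det_diagonal_add_replicateCol_mul_replicateRow]
  simp only [neg_mul, one_mul, Finset.sum_neg_distrib, ← sub_eq_add_neg, Fintype.card_fin]
  rw [key, Finset.card_fin]
  congr 2
  refine Finset.sum_congr rfl fun l _ => ?_
  rw [mul_assoc, Finset.mul_sum _ _ (lam ^ l)]
  congr 1
  refine Finset.sum_congr rfl fun t ht => ?_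
  rw [Finset.prod_mul_distrib, Finset.prod_const, (Finset.mem_powersetCard.1 ht).2]
end
end

section
/- Let d ≥ 2, let a_1, …, a_d > 0, and let λ > λ_c. Then the map f : [0,1]^d → [0,1]^d defined by f_i(x) = exp(−λ Σ_{j≠i} a_j (1 − x_j)) has a fixed point lying in the open cube (0,1)^d, and this fixed point is the unique fixed point of f in (0,1)^d. -/
open Finset

noncomputable section

/-- If `1` is an eigenvalue of `M_λ` with `λ > 0`, then `i ↦ 1 / (1 + λ aᵢ)` is a positive
eigenvector. -/
theorem hamM_positive_eigenvector {d : ℕ} {a : Fin d → ℝ} (ha : ∀ i, 0 < a i) {lam : ℝ}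
    (hlam : 0 < lam) (hroot : (hamM d a lam - 1).det = 0) (i : Fin d) :
    lam * ∑ j ∈ univ.erase i, a j * (1 / (1 + lam * a j)) = 1 / (1 + lam * a i) := by
  have hpos : ∀ j, 0 < 1 + lam * a j := fun j => by have := mul_pos hlam (ha j); linarith
  obtain ⟨v, hv, hMv⟩ := Matrix.exists_mulVec_eq_zero_iff.mpr hroot
  have hrow : ∀ j, v j * (1 + lam * a j) = lam * ∑ k, a k * v k := by
    intro j
    have h := congrFun hMv j
    rw [Matrix.sub_mulVec, Matrix.one_mulVec, Pi.sub_apply, Pi.zero_apply] at h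
    simp only [Matrix.mulVec, dotProduct, hamM, Matrix.of_apply, ite_mul, zero_mul] at h
    rw [← Finset.add_sum_erase _ _ (mem_univ j), if_pos rfl,
      Finset.sum_congr rfl (g := fun k => lam * (a k * v k))
        (fun k hk => by rw [if_neg (ne_of_mem_erase hk).symm, mul_assoc]),
      ← Finset.mul_sum] at h
    rw [← Finset.add_sum_erase _ _ (mem_univ j)]
    linear_combination -h
  set S := ∑ k, a k * v k with hS
  have hv_eq : ∀ j, v j = lam * S * (1 / (1 + lam * a j)) := by
    intro j
    have := (hpos j).ne'
    field_simp
    linarith [hrow j]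
  have hS0 : S ≠ 0 := by
    intro h0
    apply hv
    funext j
    simp [hv_eq j, h0]
  have hsum : lam * ∑ k, a k * (1 / (1 + lam * a k)) = 1 := by
    apply mul_left_cancel₀ hS0
    calc S * (lam * ∑ k, a k * (1 / (1 + lam * a k)))
        = ∑ k, a k * v k := by
          simp only [Finset.mul_sum]
          exact Finset.sum_congr rfl fun k _ => by rw [hv_eq k]; ring
      _ = S * 1 := by rw [mul_one]
  rw [← Finset.add_sum_erase _ _ (mem_univ i)] at hsum
  have h1 := (hpos i).ne'
  have h2 : lam * (a i * (1 / (1 + lam * a i))) + 1 / (1 + lam * a i) = 1 := by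
    field_simp
    ring
  linarith

theorem div_one_add_le_one_sub_exp_neg {y : ℝ} (hy : 0 ≤ y) :
    y / (1 + y) ≤ 1 - Real.exp (-y) := by
  have h1 : 0 < 1 + y := by linarith
  have h2 : Real.exp (-y) ≤ (1 + y)⁻¹ := by
    rw [Real.exp_neg]
    exact inv_anti₀ h1 (by linarith [Real.add_one_le_exp y])
  have h3 : y / (1 + y) = 1 - (1 + y)⁻¹ := by
    field_simp
    ring
  linarith

theorem mul_one_sub_exp_neg_lt {t s : ℝ} (ht0 : 0 < t) (ht1 : t < 1) (hs : 0 < s) :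
    t * (1 - Real.exp (-s)) < 1 - Real.exp (-(t * s)) := by
  have h := strictConvexOn_exp.2 (Set.mem_univ (-s)) (Set.mem_univ 0) (by linarith) ht0
    (sub_pos.mpr ht1) (by ring)
  simp only [smul_eq_mul, mul_zero, add_zero, Real.exp_zero, mul_one, mul_neg] at h
  linarith

/-- A monotone self-map of an order interval in `Fin d → ℝ` has a fixed point there. -/
theorem exists_fixed_point_mem_Icc {d : ℕ} {p q : Fin d → ℝ} (hpq : p ≤ q)
    {g : (Fin d → ℝ) → Fin d → ℝ} (hg : Monotone g) (hp : p ≤ g p) (hq : g q ≤ q) :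
    ∃ u ∈ Set.Icc p q, g u = u := by
  have : Fact (p ≤ q) := ⟨hpq⟩
  let G : Set.Icc p q →o Set.Icc p q :=
    { toFun := fun u => ⟨g u, hp.trans (hg u.2.1), (hg u.2.2).trans hq⟩
      monotone' := fun _ _ h => hg h }
  have h := G.map_lfp
  exact ⟨_, (OrderHom.lfp G).2, congrArg Subtype.val h⟩

/-- Every positive solution of `uᵢ = 1 − exp(−λ Σ_{j≠i} aⱼ uⱼ)` dominates every other one; in
particular there is at most one. -/
theorem positive_solution_le {d : ℕ} {a : Fin d → ℝ} (ha : ∀ i, 0 < a i) {lam : ℝ}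
    (hlam : 0 < lam) {u w : Fin d → ℝ} (hu : ∀ i, 0 < u i) (hw : ∀ i, 0 < w i)
    (hfu : ∀ i, u i = 1 - Real.exp (-(lam * ∑ j ∈ univ.erase i, a j * u j)))
    (hfw : ∀ i, w i = 1 - Real.exp (-(lam * ∑ j ∈ univ.erase i, a j * w j))) : w ≤ u := by
  intro i
  obtain ⟨k, -, hk⟩ := Finset.exists_min_image univ (fun j => u j / w j) ⟨i, mem_univ i⟩
  set t := u k / w k with ht
  have ht0 : 0 < t := div_pos (hu k) (hw k)
  have hle : ∀ j, t * w j ≤ u j := fun j => (le_div_iff₀ (hw j)).mp (hk j (mem_univ j))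
  have ht1 : 1 ≤ t := by
    by_contra! hlt
    set s := lam * ∑ j ∈ univ.erase k, a j * w j with hs
    have hs0 : 0 < s := by
      have h := hw k
      rw [hfw k, sub_pos, Real.exp_lt_one_iff] at h
      linarith
    have h1 := mul_one_sub_exp_neg_lt ht0 hlt hs0
    have h2 : t * s ≤ lam * ∑ j ∈ univ.erase k, a j * u j := by
      rw [hs, mul_left_comm, Finset.mul_sum]
      refine mul_le_mul_of_nonneg_left (Finset.sum_le_sum fun j _ => ?_) hlam.le
      rw [mul_left_comm]
      exact mul_le_mul_of_nonneg_left (hle j) (ha j).le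
    have h3 := Real.exp_le_exp.mpr (neg_le_neg h2)
    have h4 : t * w k = u k := div_mul_cancel₀ _ (hw k).ne'
    rw [← hfw k, h4] at h1
    linarith [hfu k]
  exact (le_mul_of_one_le_left (hw i).le ht1).trans (hle i)

/-- Above the critical value, `uᵢ = 1 − exp(−λ Σ_{j≠i} aⱼ uⱼ)` has a positive solution. -/
theorem exists_positive_solution {d : ℕ} {a : Fin d → ℝ} (ha : ∀ i, 0 < a i) {lamc lam : ℝ}
    (hc : 0 < lamc) (hroot : (hamM d a lamc - 1).det = 0) (hsup : lamc < lam) :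
    ∃ u : Fin d → ℝ, (∀ i, 0 < u i) ∧
      ∀ i, u i = 1 - Real.exp (-(lam * ∑ j ∈ univ.erase i, a j * u j)) := by
  have hlam : 0 < lam := hc.trans hsup
  set v : Fin d → ℝ := fun i => 1 / (1 + lamc * a i) with hv
  have hv0 : ∀ i, 0 < v i := fun i => by
    have := mul_pos hc (ha i)
    positivity
  have hv1 : ∀ i, v i ≤ 1 := fun i => by
    have := mul_pos hc (ha i)
    exact (div_le_one (by linarith)).mpr (by linarith)
  have hMv : ∀ i, lamc * ∑ j ∈ univ.erase i, a j * v j = v i :=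
    hamM_positive_eigenvector ha hc hroot
  set e := (lam - lamc) / lam with he
  have he0 : 0 < e := div_pos (sub_pos.mpr hsup) hlam
  have he1 : e ≤ 1 := (div_le_one hlam).mpr (by linarith)
  obtain ⟨u, hu, hfix⟩ := exists_fixed_point_mem_Icc (p := fun i => e * v i) (q := fun _ => 1)
    (g := fun u i => 1 - Real.exp (-(lam * ∑ j ∈ univ.erase i, a j * u j)))
    (fun i => mul_le_one₀ he1 (hv0 i).le (hv1 i))
    (fun x y hxy i => by
      refine sub_le_sub_left (Real.exp_le_exp.mpr (neg_le_neg ?_)) _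
      exact mul_le_mul_of_nonneg_left
        (Finset.sum_le_sum fun j _ => mul_le_mul_of_nonneg_left (hxy j) (ha j).le) hlam.le)
    (fun i => by
      have hy : lam * ∑ j ∈ univ.erase i, a j * (e * v j) = (lam - lamc) / lamc * v i := by
        rw [← hMv i, Finset.sum_congr rfl (fun j _ => mul_left_comm (a j) e (v j)),
          ← Finset.mul_sum, he]
        field_simp
      have hr : 0 < (lam - lamc) / lamc := div_pos (sub_pos.mpr hsup) hc
      have hy0 : 0 ≤ (lam - lamc) / lamc * v i := (mul_pos hr (hv0 i)).le
      change e * v i ≤ 1 - Real.exp (-(lam * ∑ j ∈ univ.erase i, a j * (e * v j)))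
      rw [hy]
      refine le_trans ?_ (div_one_add_le_one_sub_exp_neg hy0)
      calc e * v i = (lam - lamc) / lamc * v i / (1 + (lam - lamc) / lamc) := by
            have h1 : 1 + (lam - lamc) / lamc = lam / lamc := by
              field_simp
              ring
            rw [he, h1]
            field_simp
        _ ≤ (lam - lamc) / lamc * v i / (1 + (lam - lamc) / lamc * v i) := by
            refine div_le_div_of_nonneg_left hy0 (by linarith) ?_
            have := mul_le_of_le_one_right hr.le (hv1 i)
            linarith)
    (fun i => sub_le_self _ (Real.exp_pos _).le)
  exact ⟨u, fun i => (mul_pos he0 (hv0 i)).trans_le (hu.1 i), fun i => (congrFun hfix i).symm⟩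

/-- For `λ > λ_c`, the map `f : [0,1]^d → [0,1]^d` with
`fᵢ(x) = exp(−λ Σ_{j≠i} aⱼ (1−xⱼ))` has a unique fixed point in the open cube `(0,1)^d`. -/
theorem fixed_point_exists_unique (d : ℕ) (hd : 2 ≤ d) (a : Fin d → ℝ)
    (ha : ∀ i, 0 < a i) (lamc : ℝ) (hlamc_pos : 0 < lamc)
    (hlamc_root : (hamM d a lamc - 1).det = 0)
    (lam : ℝ) (hsup : lamc < lam) :
    ∃! x : Fin d → ℝ, (∀ i, x i ∈ Set.Ioo (0 : ℝ) 1) ∧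
      ∀ i, x i = Real.exp (-lam * ∑ j ∈ Finset.univ.erase i, a j * (1 - x j)) := by
  have hlam : 0 < lam := hlamc_pos.trans hsup
  obtain ⟨u, hu, hfu⟩ := exists_positive_solution ha hlamc_pos hlamc_root hsup
  refine ⟨fun i => 1 - u i, ⟨fun i => ⟨?_, sub_lt_self _ (hu i)⟩, fun i => ?_⟩, ?_⟩
  · change 0 < 1 - u i
    rw [hfu i, sub_sub_cancel]
    exact Real.exp_pos _
  · simp only [sub_sub_cancel, neg_mul]
    linarith [hfu i]
  · rintro x ⟨hx, hfx⟩
    have hw : ∀ i, 0 < 1 - x i := fun i => sub_pos.mpr (hx i).2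
    have hfw : ∀ i, 1 - x i =
        1 - Real.exp (-(lam * ∑ j ∈ univ.erase i, a j * (1 - x j))) := fun i => by
      rw [← neg_mul, ← hfx i]
    have h1 := positive_solution_le ha hlam hu hw hfu hfw
    have h2 := positive_solution_le ha hlam hw hu hfw hfu
    funext i
    linarith [h1 i, h2 i]
end
end

section
/- Let d ≥ 1 and for each i ∈ {1,…,d} let ν_i be a probability distribution on ℕ^d with mean matrix M given by M_{ij} = E_{X∼ν_i}[X_j]. Suppose there exist ρ ∈ (0,1) and a vector μ ∈ ℝ^d with all entries strictly positive such that Mμ = ρμ, and suppose there exists θ_0 > 0 such that E_{X∼ν_i}[ e^{θ_0 ⟨X, μ⟩} ] < ∞ for every i. Let (S_t)_{t≥0} be the associated branching random walk with deterministic initial state S_0 ∈ ℕ^d, and let T = inf{ t ≥ 0 : S_t = 0 }. Define e^{−α} := min_{θ ∈ [0, θ_0]} max_{i} E_{X∼ν_i}[ e^{θ ⟨X − e_i, μ⟩} ], let θ' ∈ [0, θ_0] attain this minimum, and set C := e^{θ' ⟨S_0, μ⟩}. Then α > 0 and, for every x ≥ 0, P(T > x) ≤ C·e^{−α x}. -/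
open Finset

noncomputable section

/-- `aliveProb ν t v` is the probability that the branching random walk with offspring
distributions `ν` started at `v` has not been absorbed at `0` by time `t`; that is,
`P(S_t ≠ 0 | S_0 = v) = P(T > t | S_0 = v)`, where `T = inf{t : S_t = 0}`.
In one step from a state `v ≠ 0`, a type `J` is chosen with probability `v J / ‖v‖₁`,
`X ∼ ν J` is drawn, and the state moves to `v + X − e_J`; the state `0` is absorbing. -/
def aliveProb {d : ℕ} (ν : Fin d → PMF (Fin d → ℕ)) : ℕ → (Fin d → ℕ) → ℝ
  | 0, v => if v = 0 then 0 else 1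
  | (t + 1), v =>
      if v = 0 then 0
      else
        ∑ i : Fin d, ((v i : ℝ) / ∑ j, (v j : ℝ)) *
          ∑' x : Fin d → ℕ,
            (ν i x).toReal *
              aliveProb ν t (fun j => v j + x j - if j = i then 1 else 0)

/-- The moment generating function `E_{X ∼ ν_i}[exp (θ ⟨X − e_i, μ⟩)]`. -/
def stepMgf {d : ℕ} (ν : Fin d → PMF (Fin d → ℕ)) (μ : Fin d → ℝ) (i : Fin d)
    (θ : ℝ) : ℝ :=
  ∑' x : Fin d → ℕ,
    (ν i x).toReal *
      Real.exp (θ * ∑ j, μ j * ((x j : ℝ) - if j = i then 1 else 0))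

lemma aliveProb_nonneg {d : ℕ} (ν : Fin d → PMF (Fin d → ℕ)) (t : ℕ) (v : Fin d → ℕ) :
    0 ≤ aliveProb ν t v := by
  induction t generalizing v with
  | zero => rw [aliveProb]; split_ifs <;> norm_num
  | succ t ih =>
    rw [aliveProb]
    split_ifs
    · exact le_rfl
    · exact Finset.sum_nonneg fun i _ => mul_nonneg (by positivity)
        (tsum_nonneg fun x => mul_nonneg ENNReal.toReal_nonneg (ih _))

lemma sum_mul_sub_indicator {d : ℕ} (μ : Fin d → ℝ) (i : Fin d) (x : Fin d → ℕ) :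
    ∑ j, μ j * ((x j : ℝ) - if j = i then 1 else 0) = ∑ j, μ j * (x j : ℝ) - μ i := by
  simp [mul_sub, Finset.sum_sub_distrib]

lemma hasSum_toReal_pmf {β : Type*} (p : PMF β) : HasSum (fun x => (p x).toReal) 1 := by
  have h := (ENNReal.summable_toReal p.tsum_coe_ne_top).hasSum
  rwa [← ENNReal.tsum_toReal_eq p.apply_ne_top, p.tsum_coe, ENNReal.toReal_one] at h

lemma summable_pmf_mul_exp {d : ℕ} (p : PMF (Fin d → ℕ)) {μ : Fin d → ℝ} (hμ : ∀ i, 0 < μ i)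
    {θ θ₀ : ℝ} (hθ : θ ≤ θ₀) (c : ℝ)
    (hmom : Summable fun x : Fin d → ℕ =>
      (p x).toReal * Real.exp (θ₀ * ∑ j, μ j * (x j : ℝ))) :
    Summable fun x : Fin d → ℕ =>
      (p x).toReal * Real.exp (θ * (∑ j, μ j * (x j : ℝ) - c)) := by
  refine Summable.of_nonneg_of_le (fun x => by positivity) (fun x => ?_)
    (hmom.mul_left (Real.exp (-(θ * c))))
  have hs : 0 ≤ ∑ j, μ j * (x j : ℝ) :=
    Finset.sum_nonneg fun j _ => mul_nonneg (hμ j).le (Nat.cast_nonneg _)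
  rw [mul_left_comm, ← Real.exp_add]
  gcongr
  nlinarith

lemma summable_pmf_mul_inner {d : ℕ} (p : PMF (Fin d → ℕ)) {μ : Fin d → ℝ}
    (hμ : ∀ i, 0 < μ i) {θ₀ : ℝ} (hθ₀ : 0 < θ₀)
    (hmom : Summable fun x : Fin d → ℕ =>
      (p x).toReal * Real.exp (θ₀ * ∑ j, μ j * (x j : ℝ))) :
    Summable fun x : Fin d → ℕ => (p x).toReal * ∑ j, μ j * (x j : ℝ) := by
  have hs (x : Fin d → ℕ) : 0 ≤ ∑ j, μ j * (x j : ℝ) :=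
    Finset.sum_nonneg fun j _ => mul_nonneg (hμ j).le (Nat.cast_nonneg _)
  refine Summable.of_nonneg_of_le (fun x => mul_nonneg ENNReal.toReal_nonneg (hs x))
    (fun x => ?_) (hmom.mul_left θ₀⁻¹)
  rw [mul_left_comm]
  gcongr
  rw [le_inv_mul_iff₀ hθ₀]
  linarith [Real.add_one_le_exp (θ₀ * ∑ j, μ j * (x j : ℝ))]

lemma tsum_pmf_mul_inner {d : ℕ} (p : PMF (Fin d → ℕ)) {μ : Fin d → ℝ} (hμ : ∀ i, 0 < μ i)
    (hsum : Summable fun x : Fin d → ℕ => (p x).toReal * ∑ j, μ j * (x j : ℝ)) :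
    ∑' x : Fin d → ℕ, (p x).toReal * ∑ j, μ j * (x j : ℝ) =
      ∑ j, (∑' x : Fin d → ℕ, (p x).toReal * (x j : ℝ)) * μ j := by
  have hj (j : Fin d) : Summable fun x : Fin d → ℕ => (p x).toReal * (x j : ℝ) * μ j := by
    refine Summable.of_nonneg_of_le (fun x => ?_) (fun x => ?_) hsum
    · have := (hμ j).le
      positivity
    · rw [mul_assoc, mul_comm (x j : ℝ)]
      refine mul_le_mul_of_nonneg_left ?_ ENNReal.toReal_nonneg
      exact Finset.single_le_sum (f := fun j => μ j * (x j : ℝ))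
        (fun k _ => mul_nonneg (hμ k).le (Nat.cast_nonneg _)) (Finset.mem_univ j)
  simp_rw [← tsum_mul_right]
  rw [← Summable.tsum_finsetSum fun j _ => hj j]
  refine tsum_congr fun x => ?_
  rw [Finset.mul_sum]
  exact Finset.sum_congr rfl fun j _ => by ring

lemma le_exp_mul_sub_one_div {θ : ℝ} (hθ : 0 < θ) (y : ℝ) :
    y ≤ (Real.exp (θ * y) - 1) / θ := by
  rw [le_div_iff₀ hθ]
  linarith [Real.add_one_le_exp (θ * y)]

lemma exp_mul_sub_one_div_mono {θ θ₀ : ℝ} (hθ : 0 < θ) (hle : θ ≤ θ₀) (y : ℝ) :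
    (Real.exp (θ * y) - 1) / θ ≤ (Real.exp (θ₀ * y) - 1) / θ₀ := by
  have hθ₀ := hθ.trans_le hle
  have h := convexOn_exp.2 (Set.mem_univ 0) (Set.mem_univ (θ₀ * y))
    (sub_nonneg.2 ((div_le_one hθ₀).2 hle)) (div_pos hθ hθ₀).le (sub_add_cancel _ _)
  have he : θ / θ₀ * (θ₀ * y) = θ * y := by field_simp
  simp only [smul_eq_mul, mul_zero, zero_add, Real.exp_zero, mul_one, he] at h
  rw [div_le_iff₀ hθ]
  calc Real.exp (θ * y) - 1 ≤ θ / θ₀ * Real.exp (θ₀ * y) - θ / θ₀ := by linarith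
    _ = (Real.exp (θ₀ * y) - 1) / θ₀ * θ := by ring

lemma tendsto_exp_mul_sub_one_div (y : ℝ) :
    Filter.Tendsto (fun θ : ℝ => (Real.exp (θ * y) - 1) / θ) (nhdsWithin 0 (Set.Ioi 0))
      (nhds y) := by
  have h : HasDerivAt (fun θ : ℝ => Real.exp (θ * y)) y 0 := by
    simpa using ((hasDerivAt_id (0 : ℝ)).mul_const y).exp
  have h' := h.tendsto_slope_zero_right
  refine h'.congr fun θ => ?_
  simp [div_eq_inv_mul]

/-- Negative drift makes the exponential moment of a step drop below `1` near `θ = 0`. -/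
lemma eventually_stepMgf_lt_one {d : ℕ} (ν : Fin d → PMF (Fin d → ℕ)) {μ : Fin d → ℝ}
    (hμ : ∀ i, 0 < μ i) {θ₀ : ℝ} (hθ₀ : 0 < θ₀) (i : Fin d)
    (hmom : Summable fun x : Fin d → ℕ =>
      (ν i x).toReal * Real.exp (θ₀ * ∑ j, μ j * (x j : ℝ)))
    (hdrift : ∑ j, (∑' x : Fin d → ℕ, (ν i x).toReal * (x j : ℝ)) * μ j < μ i) :
    ∀ᶠ θ in nhdsWithin (0 : ℝ) (Set.Ioi 0), stepMgf ν μ i θ < 1 := by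
  set y : (Fin d → ℕ) → ℝ := fun x => ∑ j, μ j * (x j : ℝ) - μ i with hy
  have hp := hasSum_toReal_pmf (ν i)
  have hin := summable_pmf_mul_inner (ν i) hμ hθ₀ hmom
  have hsy : Summable fun x => (ν i x).toReal * y x := by
    simpa only [hy, mul_sub] using hin.sub (hp.summable.mul_right (μ i))
  have hexp {θ : ℝ} (h : θ ≤ θ₀) : Summable fun x => (ν i x).toReal * Real.exp (θ * y x) :=
    summable_pmf_mul_exp (ν i) hμ h (μ i) hmom
  have hquot {θ : ℝ} (h : θ ≤ θ₀) : HasSum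
      (fun x => (ν i x).toReal * ((Real.exp (θ * y x) - 1) / θ))
      ((stepMgf ν μ i θ - 1) / θ) := by
    have h1 := ((hexp h).hasSum.sub hp).div_const θ
    have h2 : stepMgf ν μ i θ = ∑' x, (ν i x).toReal * Real.exp (θ * y x) := by
      simp only [stepMgf, sum_mul_sub_indicator, hy]
    rw [h2]
    simpa only [mul_div_assoc', mul_sub, mul_one] using h1
  have hbound : Summable fun x => (ν i x).toReal * |y x| +
      (ν i x).toReal * |(Real.exp (θ₀ * y x) - 1) / θ₀| := by
    refine Summable.add ?_ ?_
    · simpa [abs_mul] using hsy.abs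
    · simpa [abs_mul] using (hquot le_rfl).summable.abs
  have hmem : ∀ᶠ θ in nhdsWithin (0 : ℝ) (Set.Ioi 0), θ ∈ Set.Ioc 0 θ₀ :=
    Ioc_mem_nhdsGT hθ₀
  have hlim := tendsto_tsum_of_dominated_convergence
    (f := fun (θ : ℝ) x => (ν i x).toReal * ((Real.exp (θ * y x) - 1) / θ))
    (g := fun x => (ν i x).toReal * y x) (𝓕 := nhdsWithin (0 : ℝ) (Set.Ioi 0)) hbound
    (fun x => (tendsto_exp_mul_sub_one_div (y x)).const_mul _)
    (hmem.mono fun θ hθ x => by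
      rw [← mul_add, norm_mul, Real.norm_of_nonneg ENNReal.toReal_nonneg, Real.norm_eq_abs]
      refine mul_le_mul_of_nonneg_left (abs_le.2 ⟨?_, ?_⟩) ENNReal.toReal_nonneg
      · linarith [le_exp_mul_sub_one_div hθ.1 (y x), neg_abs_le (y x),
          abs_nonneg ((Real.exp (θ₀ * y x) - 1) / θ₀)]
      · linarith [exp_mul_sub_one_div_mono hθ.1 hθ.2 (y x), abs_nonneg (y x),
          le_abs_self ((Real.exp (θ₀ * y x) - 1) / θ₀)])
  have hneg : ∑' x, (ν i x).toReal * y x < 0 := by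
    simp only [hy, mul_sub]
    rw [hin.tsum_sub (hp.summable.mul_right _), tsum_mul_right, hp.tsum_eq,
      tsum_pmf_mul_inner (ν i) hμ hin]
    linarith
  filter_upwards [hmem, hlim.eventually_lt_const hneg] with θ hθ hlt
  rw [(hquot hθ.2).tsum_eq, div_lt_iff₀ hθ.1] at hlt
  linarith

lemma exp_neg_le_stepMgf {d : ℕ} (ν : Fin d → PMF (Fin d → ℕ)) {μ : Fin d → ℝ}
    (hμ : ∀ i, 0 < μ i) {θ : ℝ} (hθ : 0 ≤ θ) (i : Fin d)
    (hsum : Summable fun x : Fin d → ℕ =>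
      (ν i x).toReal * Real.exp (θ * (∑ j, μ j * (x j : ℝ) - μ i))) :
    Real.exp (-(θ * μ i)) ≤ stepMgf ν μ i θ := by
  have hp := (hasSum_toReal_pmf (ν i)).mul_right (Real.exp (-(θ * μ i)))
  rw [one_mul] at hp
  simp only [stepMgf, sum_mul_sub_indicator]
  rw [← hp.tsum_eq]
  refine hp.summable.tsum_le_tsum (fun x => ?_) hsum
  have hs : 0 ≤ ∑ j, μ j * (x j : ℝ) :=
    Finset.sum_nonneg fun j _ => mul_nonneg (hμ j).le (Nat.cast_nonneg _)
  gcongr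
  nlinarith

/-- The supermartingale bound: the extra factor `m` comes from the fact that a nonzero state
has at least one particle. -/
lemma aliveProb_le {d : ℕ} (ν : Fin d → PMF (Fin d → ℕ)) {μ : Fin d → ℝ}
    (hμ : ∀ i, 0 < μ i) {θ : ℝ} (hθ : 0 ≤ θ) {m : ℝ} (hm : ∀ i, stepMgf ν μ i θ ≤ m)
    (hm0 : 0 ≤ m)
    (hsum : ∀ i, Summable fun x : Fin d → ℕ =>
      (ν i x).toReal * Real.exp (θ * (∑ j, μ j * (x j : ℝ) - μ i)))
    (t : ℕ) (v : Fin d → ℕ) :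
    aliveProb ν t v ≤ m ^ (t + 1) * Real.exp (θ * ∑ j, μ j * (v j : ℝ)) := by
  induction t generalizing v with
  | zero =>
    rw [aliveProb]
    split_ifs with hv
    · positivity
    obtain ⟨i, hi⟩ := Function.ne_iff.1 hv
    have hi1 : (1 : ℝ) ≤ v i := by exact_mod_cast Nat.one_le_iff_ne_zero.2 hi
    have hsingle : μ i * (v i : ℝ) ≤ ∑ j, μ j * (v j : ℝ) :=
      Finset.single_le_sum (f := fun j => μ j * (v j : ℝ))
        (fun k _ => mul_nonneg (hμ k).le (Nat.cast_nonneg _)) (Finset.mem_univ i)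
    have hle : μ i ≤ ∑ j, μ j * (v j : ℝ) := by nlinarith [hμ i]
    calc (1 : ℝ) = Real.exp (-(θ * μ i)) * Real.exp (θ * μ i) := by
          rw [← Real.exp_add]; simp
      _ ≤ m ^ (0 + 1) * Real.exp (θ * ∑ j, μ j * (v j : ℝ)) := by
          rw [zero_add, pow_one]
          have := (exp_neg_le_stepMgf ν hμ hθ i (hsum i)).trans (hm i)
          gcongr
  | succ t ih =>
    rw [aliveProb]
    split_ifs with hv
    · positivity
    set E := Real.exp (θ * ∑ j, μ j * (v j : ℝ)) with hE
    have hpos : 0 < ∑ j, (v j : ℝ) := by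
      obtain ⟨i, hi⟩ := Function.ne_iff.1 hv
      exact Finset.sum_pos' (fun j _ => Nat.cast_nonneg _)
        ⟨i, Finset.mem_univ i, by exact_mod_cast Nat.pos_of_ne_zero hi⟩
    have key (i : Fin d) (hi : v i ≠ 0) :
        ∑' x : Fin d → ℕ, (ν i x).toReal *
          aliveProb ν t (fun j => v j + x j - if j = i then 1 else 0) ≤
            m ^ (t + 1 + 1) * E := by
      have hle (x : Fin d → ℕ) : (ν i x).toReal *
          aliveProb ν t (fun j => v j + x j - if j = i then 1 else 0) ≤
          m ^ (t + 1) * E *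
            ((ν i x).toReal * Real.exp (θ * (∑ j, μ j * (x j : ℝ) - μ i))) := by
        have hcast (j : Fin d) : ((v j + x j - if j = i then 1 else 0 : ℕ) : ℝ) =
            v j + ((x j : ℝ) - if j = i then 1 else 0) := by
          split_ifs with h
          · subst h
            rw [Nat.cast_sub (by omega)]
            push_cast
            ring
          · simp
        have h := ih (fun j => v j + x j - if j = i then 1 else 0)
        simp only [hcast] at h
        simp only [mul_add (μ _), Finset.sum_add_distrib, sum_mul_sub_indicator,
          mul_add θ, Real.exp_add] at h
        calc _ ≤ (ν i x).toReal * _ := mul_le_mul_of_nonneg_left h ENNReal.toReal_nonneg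
          _ = _ := by rw [hE]; ring
      have hs := (hsum i).mul_left (m ^ (t + 1) * E)
      have hsum' := Summable.of_nonneg_of_le
        (fun x => mul_nonneg ENNReal.toReal_nonneg (aliveProb_nonneg ν t _)) hle hs
      refine (hsum'.tsum_le_tsum hle hs).trans ?_
      have hmi := hm i
      simp only [stepMgf, sum_mul_sub_indicator] at hmi
      rw [tsum_mul_left, pow_succ m (t + 1)]
      calc m ^ (t + 1) * E * _ ≤ m ^ (t + 1) * E * m := by gcongr
        _ = m ^ (t + 1) * m * E := by ring
    calc _ ≤ ∑ i : Fin d, ((v i : ℝ) / ∑ j, (v j : ℝ)) * (m ^ (t + 1 + 1) * E) := by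
          refine Finset.sum_le_sum fun i _ => ?_
          by_cases hi : v i = 0
          · simp [hi]
          · exact mul_le_mul_of_nonneg_left (key i hi) (by positivity)
      _ = _ := by rw [← Finset.sum_mul, ← Finset.sum_div, div_self hpos.ne', one_mul]

/-- **Proposition 2.2.** For a subcritical multitype branching random walk
(mean matrix `M` with `Mμ = ρμ`, `0 < ρ < 1`, `μ > 0`, and exponential moments up to
`θ₀ > 0`), defining `e^{−α} = min_{θ ∈ [0,θ₀]} max_i E[e^{θ⟨X−e_i,μ⟩}]` (attained at `θ'`)
and `C = e^{θ'⟨S₀,μ⟩}`, we have `α > 0` and `P(T > x) ≤ C e^{−αx}` for all `x ≥ 0`. -/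
theorem absorption_time_tail_bound (d : ℕ) (hd : 1 ≤ d)
    (ν : Fin d → PMF (Fin d → ℕ))
    (ρ : ℝ) (hρ : ρ ∈ Set.Ioo (0 : ℝ) 1)
    (μ : Fin d → ℝ) (hμ : ∀ i, 0 < μ i)
    (hEig : ∀ i, ∑ j, (∑' x : Fin d → ℕ, (ν i x).toReal * (x j : ℝ)) * μ j = ρ * μ i)
    (θ₀ : ℝ) (hθ₀ : 0 < θ₀)
    (hmom : ∀ i, Summable fun x : Fin d → ℕ =>
        (ν i x).toReal * Real.exp (θ₀ * ∑ j, μ j * (x j : ℝ)))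
    (θ' : ℝ) (hθ' : θ' ∈ Set.Icc 0 θ₀)
    (hmin : ∀ θ ∈ Set.Icc 0 θ₀, (⨆ i, stepMgf ν μ i θ') ≤ ⨆ i, stepMgf ν μ i θ)
    (S₀ : Fin d → ℕ)
    (α : ℝ) (hα : Real.exp (-α) = ⨆ i, stepMgf ν μ i θ')
    (C : ℝ) (hC : C = Real.exp (θ' * ∑ j, μ j * (S₀ j : ℝ))) :
    0 < α ∧ ∀ x : ℝ, 0 ≤ x →
      aliveProb ν (Nat.floor x) S₀ ≤ C * Real.exp (-α * x) := by
  have : Nonempty (Fin d) := ⟨⟨0, hd⟩⟩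
  have hα0 : 0 < α := by
    have hev : ∀ᶠ θ in nhdsWithin (0 : ℝ) (Set.Ioi 0), ∀ i, stepMgf ν μ i θ < 1 := by
      refine Filter.eventually_all.2 fun i =>
        eventually_stepMgf_lt_one ν hμ hθ₀ i (hmom i) ?_
      rw [hEig i]
      nlinarith [hμ i, hρ.2]
    obtain ⟨θ, hlt, hθ⟩ := (hev.and (Ioc_mem_nhdsGT hθ₀)).exists
    obtain ⟨i, hi⟩ := exists_eq_ciSup_of_finite (f := fun i => stepMgf ν μ i θ)
    have h := hmin θ ⟨hθ.1.le, hθ.2⟩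
    rw [← hα, ← hi] at h
    have h1 := h.trans_lt (hlt i)
    rw [Real.exp_lt_one_iff] at h1
    linarith
  refine ⟨hα0, fun x hx => ?_⟩
  have hm (i : Fin d) : stepMgf ν μ i θ' ≤ Real.exp (-α) :=
    hα ▸ le_ciSup (f := fun i => stepMgf ν μ i θ') (Set.finite_range _).bddAbove i
  refine (aliveProb_le ν hμ hθ'.1 hm (Real.exp_pos _).le
    (fun i => summable_pmf_mul_exp (ν i) hμ hθ'.2 (μ i) (hmom i)) _ S₀).trans ?_
  rw [hC, mul_comm, ← Real.exp_nat_mul]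
  refine mul_le_mul_of_nonneg_left (Real.exp_le_exp.2 ?_) (Real.exp_pos _).le
  have := Nat.lt_floor_add_one x
  push_cast
  nlinarith
end
end

section
/- Fix d ≥ 2, reals a_1, …, a_d > 0, λ > 0, and n ∈ ℕ with 0 < λ < n and n·a_j ∈ ℕ for every j. For each i ∈ {1,…,d}, let ν_i be the law on ℕ^d of a random vector with independent coordinates whose j-th coordinate is Binomial(a_j n, λ/n) for j ≠ i and is identically 0 for j = i. Suppose the matrix M_λ satisfies M_λ μ = ρ μ with ρ > 1 and μ ∈ ℝ^d having all entries strictly positive and ‖μ‖₁ = 1; write μ_max = max_i μ_i and μ_min = min_i μ_i. Let (S_t)_{t≥0} be the associated branching random walk with deterministic initial state S_0 ∈ ℕ^d, S_0 ≠ 0, and let T = inf{t ≥ 0 : S_t = 0}. Then: (i) for every x > 1 there exists η₁ > 0 such that for all t ≥ 0 and all S_0, P( ⟨S_t − S_0, μ⟩ ≥ x (ρ−1) μ_max t ) ≤ e^{−η₁ t}; and (ii) for every y < 1 there exists η₂ > 0 such that for all t ≥ 0 and all S_0, P( T > t and ⟨S_t − S_0, μ⟩ ≤ y (ρ−1) μ_min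 t ) ≤ e^{−η₂ t}. -/
open Finset

noncomputable section

/-- The one-step transition probability of the branching random walk with offspring
distributions `ν`: from a state `u ≠ 0`, a type `i` is chosen with probability
`u i / ‖u‖₁`, `X ∼ ν i` is drawn, and the state moves to `u + X − e_i`; the state `0`
is absorbing. -/
def stepMass {d : ℕ} (ν : Fin d → PMF (Fin d → ℕ)) (u w : Fin d → ℕ) : ℝ :=
  if u = 0 then (if w = u then 1 else 0)
  else
    ∑ i : Fin d, ((u i : ℝ) / ∑ j, (u j : ℝ)) *
      (if ∀ j, u j ≤ w j + (if j = i then 1 else 0)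
       then (ν i fun j => w j + (if j = i then 1 else 0) - u j).toReal
       else 0)

/-- `walkMass ν t v w = P(S_t = w | S_0 = v)` for the branching random walk. -/
def walkMass {d : ℕ} (ν : Fin d → PMF (Fin d → ℕ)) : ℕ → (Fin d → ℕ) → (Fin d → ℕ) → ℝ
  | 0, v, w => if w = v then 1 else 0
  | (t + 1), v, w => ∑' u : Fin d → ℕ, walkMass ν t v u * stepMass ν u w

/-- `walkProb ν t v A = P(S_t ∈ A | S_0 = v)` for the branching random walk. -/
def walkProb {d : ℕ} (ν : Fin d → PMF (Fin d → ℕ)) (t : ℕ) (v : Fin d → ℕ)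
    (A : Set (Fin d → ℕ)) : ℝ :=
  ∑' w : Fin d → ℕ, A.indicator (walkMass ν t v) w

lemma stepMass_nonneg {d : ℕ} (ν : Fin d → PMF (Fin d → ℕ)) (u w : Fin d → ℕ) :
    0 ≤ stepMass ν u w := by
  unfold stepMass
  split_ifs
  · exact zero_le_one
  · exact le_rfl
  · refine Finset.sum_nonneg fun i _ => mul_nonneg (by positivity) ?_
    split_ifs
    · exact ENNReal.toReal_nonneg
    · exact le_rfl

lemma walkMass_nonneg {d : ℕ} (ν : Fin d → PMF (Fin d → ℕ)) (t : ℕ) (v w : Fin d → ℕ) :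
    0 ≤ walkMass ν t v w := by
  induction t generalizing w with
  | zero => unfold walkMass; split_ifs <;> norm_num
  | succ t ih =>
    exact tsum_nonneg fun u => mul_nonneg (ih u) (stepMass_nonneg ν u w)

/-- Each summand of `stepMass` is a reindexing of an offspring law along the injection
`x ↦ u + x - e_i`. -/
lemma shift_term_eq {d : ℕ} (p : (Fin d → ℕ) → ℝ) (u : Fin d → ℕ) (i : Fin d) (hu : u i ≠ 0)
    (x : Fin d → ℕ) :
    (if ∀ j, u j ≤ (u j + x j - if j = i then 1 else 0) + (if j = i then 1 else 0)
      then p fun j => (u j + x j - if j = i then 1 else 0) + (if j = i then 1 else 0) - u j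
      else 0) = p x := by
  have h : ∀ j, (u j + x j - if j = i then 1 else 0) + (if j = i then 1 else 0) = u j + x j := by
    intro j
    split_ifs with hj
    · subst hj; omega
    · simp
  simp only [h]
  simp

lemma shift_injective {d : ℕ} (u : Fin d → ℕ) (i : Fin d) (hu : u i ≠ 0) :
    Function.Injective fun (x : Fin d → ℕ) j => u j + x j - if j = i then 1 else 0 := by
  intro x y hxy
  ext j
  have := congrFun hxy j
  by_cases hj : j = i
  · subst hj; simp at this; omega
  · simpa [hj] using this

lemma shift_support {d : ℕ} (p : (Fin d → ℕ) → ℝ) (u : Fin d → ℕ) (i : Fin d) :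
    (Function.support fun w : Fin d → ℕ =>
      if ∀ j, u j ≤ w j + (if j = i then 1 else 0)
        then p fun j => w j + (if j = i then 1 else 0) - u j else 0) ⊆
      (fun (x : Fin d → ℕ) j => u j + x j - if j = i then 1 else 0) '' Function.support p := by
  intro w hw
  rw [Function.mem_support] at hw
  split_ifs at hw with h
  · refine ⟨_, hw, ?_⟩
    ext j
    have := h j
    dsimp only
    omega
  · exact absurd rfl hw

lemma stepMass_support_finite {d : ℕ} (ν : Fin d → PMF (Fin d → ℕ))
    (hfin : ∀ i, (Function.support fun x => (ν i x).toReal).Finite) (u : Fin d → ℕ) :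
    (Function.support (stepMass ν u)).Finite := by
  by_cases hu : u = 0
  · refine (Set.finite_singleton u).subset fun w hw => ?_
    by_contra h
    have h' : w ≠ u := h
    exact hw (by simp only [stepMass, if_pos hu, if_neg h'])
  · refine (Set.finite_iUnion fun i =>
      ((hfin i).image fun (x : Fin d → ℕ) j => u j + x j - if j = i then 1 else 0)).subset
        fun w hw => ?_
    have hw' : stepMass ν u w ≠ 0 := hw
    rw [stepMass, if_neg hu] at hw'
    obtain ⟨i, -, hi⟩ := Finset.exists_ne_zero_of_sum_ne_zero hw'
    exact Set.mem_iUnion.2 ⟨i, shift_support _ u i (right_ne_zero_of_mul hi)⟩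

lemma walkMass_support_finite {d : ℕ} (ν : Fin d → PMF (Fin d → ℕ))
    (hfin : ∀ i, (Function.support fun x => (ν i x).toReal).Finite) (t : ℕ) (v : Fin d → ℕ) :
    (Function.support (walkMass ν t v)).Finite := by
  induction t with
  | zero =>
    refine (Set.finite_singleton v).subset fun w hw => ?_
    by_contra h
    have h' : w ≠ v := h
    exact hw (by simp only [walkMass, if_neg h'])
  | succ t ih =>
    refine (ih.biUnion fun u _ => stepMass_support_finite ν hfin u).subset fun w hw => ?_
    by_contra h
    simp only [Set.mem_iUnion, not_exists, Function.mem_support, not_not] at h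
    refine hw ?_
    rw [walkMass]
    have hz : ∀ u, walkMass ν t v u * stepMass ν u w = 0 := fun u => by
      by_cases hu : walkMass ν t v u = 0
      · rw [hu, zero_mul]
      · rw [h u hu, mul_zero]
    simp only [hz, tsum_zero]

lemma summable_mul_of_support_finite {α : Type*} {g : α → ℝ} (hg : (Function.support g).Finite)
    (f : α → ℝ) : Summable fun w => g w * f w :=
  summable_of_hasFiniteSupport (hg.subset (Function.support_mul_subset_left g f))

/-- A Lyapunov function multiplied on average by at most `c` in one step is multiplied on
average by at most `c ^ t` in `t` steps. -/
lemma walkMass_tsum_le {d : ℕ} (ν : Fin d → PMF (Fin d → ℕ))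
    (hfin : ∀ i, (Function.support fun x => (ν i x).toReal).Finite) (f : (Fin d → ℕ) → ℝ)
    (c : ℝ) (hc : 0 ≤ c) (hdrift : ∀ u, ∑' w, stepMass ν u w * f w ≤ c * f u)
    (t : ℕ) (v : Fin d → ℕ) :
    ∑' w, walkMass ν t v w * f w ≤ c ^ t * f v := by
  induction t with
  | zero =>
    rw [tsum_eq_single v fun w hw => by simp [walkMass, hw]]
    simp [walkMass]
  | succ t ih =>
    have hS := walkMass_support_finite ν hfin t v
    have hout : ∀ u ∉ hS.toFinset, walkMass ν t v u = 0 := fun u hu => by simpa using hu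
    have h1 : ∀ w, walkMass ν (t + 1) v w * f w =
        ∑ u ∈ hS.toFinset, walkMass ν t v u * (stepMass ν u w * f w) := fun w => by
      rw [walkMass, tsum_eq_sum (s := hS.toFinset) fun u hu => by rw [hout u hu, zero_mul],
        Finset.sum_mul]
      simp only [mul_assoc]
    simp only [h1]
    rw [Summable.tsum_finsetSum fun u _ =>
      (summable_mul_of_support_finite (stepMass_support_finite ν hfin u) f).mul_left _]
    calc ∑ u ∈ hS.toFinset, ∑' w, walkMass ν t v u * (stepMass ν u w * f w)
        ≤ ∑ u ∈ hS.toFinset, c * (walkMass ν t v u * f u) := by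
          refine Finset.sum_le_sum fun u _ => ?_
          rw [tsum_mul_left]
          calc _ ≤ walkMass ν t v u * (c * f u) :=
                mul_le_mul_of_nonneg_left (hdrift u) (walkMass_nonneg ν t v u)
            _ = _ := by ring
      _ = c * ∑' w, walkMass ν t v w * f w := by
          rw [← Finset.mul_sum,
            tsum_eq_sum (s := hS.toFinset) fun u hu => by rw [hout u hu, zero_mul]]
      _ ≤ c * (c ^ t * f v) := mul_le_mul_of_nonneg_left ih hc
      _ = c ^ (t + 1) * f v := by ring

/-- Markov's inequality for the law of the walk at time `t`. -/
lemma walkProb_le {d : ℕ} (ν : Fin d → PMF (Fin d → ℕ))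
    (hfin : ∀ i, (Function.support fun x => (ν i x).toReal).Finite) (f : (Fin d → ℕ) → ℝ)
    (hf : ∀ w, 0 ≤ f w) (c : ℝ) (hc : 0 ≤ c)
    (hdrift : ∀ u, ∑' w, stepMass ν u w * f w ≤ c * f u)
    (t : ℕ) (v : Fin d → ℕ) (A : Set (Fin d → ℕ)) (K : ℝ) (hK : 0 < K) (hA : ∀ w ∈ A, K ≤ f w) :
    walkProb ν t v A ≤ c ^ t * f v / K := by
  rw [le_div_iff₀ hK]
  refine le_trans ?_ (walkMass_tsum_le ν hfin f c hc hdrift t v)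
  have hS := walkMass_support_finite ν hfin t v
  rw [walkProb, ← tsum_mul_right]
  refine Summable.tsum_le_tsum (fun w => ?_) ?_ (summable_mul_of_support_finite hS f)
  · by_cases hw : w ∈ A
    · rw [Set.indicator_of_mem hw]
      exact mul_le_mul_of_nonneg_left (hA w hw) (walkMass_nonneg ν t v w)
    · rw [Set.indicator_of_notMem hw, zero_mul]
      exact mul_nonneg (walkMass_nonneg ν t v w) (hf w)
  · exact summable_mul_of_support_finite
      (hS.subset (by rw [Set.support_indicator]; exact Set.inter_subset_right)) fun _ => K

/-- One step from a nonzero state averages the offspring expectations over the types present. -/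
lemma stepMass_tsum_le {d : ℕ} (ν : Fin d → PMF (Fin d → ℕ))
    (hfin : ∀ i, (Function.support fun x => (ν i x).toReal).Finite) (f : (Fin d → ℕ) → ℝ)
    (u : Fin d → ℕ) (hu : u ≠ 0) (K : ℝ)
    (hK : ∀ i, u i ≠ 0 →
      ∑' x : Fin d → ℕ, (ν i x).toReal * f (fun j => u j + x j - if j = i then 1 else 0) ≤ K) :
    ∑' w, stepMass ν u w * f w ≤ K := by
  have hpos : 0 < ∑ j, (u j : ℝ) := by
    obtain ⟨i, hi⟩ := Function.ne_iff.1 hu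
    exact Finset.sum_pos' (fun j _ => by positivity)
      ⟨i, Finset.mem_univ i, by exact_mod_cast Nat.pos_of_ne_zero hi⟩
  set q : Fin d → (Fin d → ℕ) → ℝ := fun i w =>
    if ∀ j, u j ≤ w j + (if j = i then 1 else 0)
      then (ν i fun j => w j + (if j = i then 1 else 0) - u j).toReal else 0 with hq
  have hqs : ∀ i, (Function.support (q i)).Finite := fun i =>
    ((hfin i).image _).subset (shift_support (fun x => (ν i x).toReal) u i)
  have h1 : ∀ w, stepMass ν u w * f w =
      ∑ i, ((u i : ℝ) / ∑ j, (u j : ℝ)) * (q i w * f w) := fun w => by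
    rw [stepMass, if_neg hu, Finset.sum_mul]
    simp only [hq, mul_assoc]
  simp only [h1]
  rw [Summable.tsum_finsetSum fun i _ => (summable_mul_of_support_finite (hqs i) f).mul_left _]
  calc ∑ i, ∑' w, ((u i : ℝ) / ∑ j, (u j : ℝ)) * (q i w * f w)
      ≤ ∑ i, ((u i : ℝ) / ∑ j, (u j : ℝ)) * K := by
        refine Finset.sum_le_sum fun i _ => ?_
        rw [tsum_mul_left]
        by_cases hi : u i = 0
        · simp [hi]
        refine mul_le_mul_of_nonneg_left ?_ (by positivity)
        refine le_trans (le_of_eq ?_) (hK i hi)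
        rw [← (shift_injective u i hi).tsum_eq (f := fun w => q i w * f w)]
        · refine tsum_congr fun x => ?_
          have := shift_term_eq (fun x => (ν i x).toReal) u i hi x
          simp only [hq]
          rw [← this]
        · exact ((Function.support_mul_subset_left _ _).trans
            (shift_support (fun x => (ν i x).toReal) u i)).trans (Set.image_subset_range _ _)
    _ = K := by rw [← Finset.sum_mul, ← Finset.sum_div, div_self hpos.ne', one_mul]

/-- The moment generating function of a binomial variable is below that of the Poisson variable
with the same mean. -/
lemma binomial_mgf_le (N : ℕ) (p s : ℝ) (hp0 : 0 ≤ p) (hp1 : p ≤ 1) :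
    ∑ k ∈ Finset.range (N + 1), (if k ≤ N then (N.choose k : ℝ) * p ^ k * (1 - p) ^ (N - k) else 0)
      * Real.exp (s * k) ≤ Real.exp (N * p * (Real.exp s - 1)) := by
  have h : ∑ k ∈ Finset.range (N + 1),
      (if k ≤ N then (N.choose k : ℝ) * p ^ k * (1 - p) ^ (N - k) else 0) * Real.exp (s * k) =
      (p * Real.exp s + (1 - p)) ^ N := by
    rw [add_pow]
    refine Finset.sum_congr rfl fun k hk => ?_
    rw [if_pos (Finset.mem_range_succ_iff.1 hk), mul_pow, ← Real.exp_nat_mul, mul_comm s]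
    ring
  rw [h, mul_assoc, Real.exp_nat_mul]
  have hes := (Real.exp_pos s).le
  refine pow_le_pow_left₀ (by have := mul_nonneg hp0 hes; linarith) ?_ N
  have := Real.add_one_le_exp (p * (Real.exp s - 1))
  linarith

lemma exp_sub_one_le (s : ℝ) (hs : |s| ≤ 1) : Real.exp s - 1 ≤ s + s ^ 2 := by
  have := (abs_le.1 (Real.abs_exp_sub_one_sub_id_le hs)).2
  linarith

/-- The real-valued mass function of a vector with independent coordinates, the `j`-th being
binomial with parameters `N j` and `p` for `j ≠ i` and zero for `j = i`. -/
def offspringMass {d : ℕ} (N : Fin d → ℕ) (p : ℝ) (i : Fin d) (x : Fin d → ℕ) : ℝ :=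
  ∏ j, if j = i then (if x j = 0 then (1 : ℝ) else 0)
    else (if x j ≤ N j then ((N j).choose (x j) : ℝ) * p ^ (x j) * (1 - p) ^ (N j - x j) else 0)

lemma offspringMass_eq_zero {d : ℕ} (N : Fin d → ℕ) (p : ℝ) (i : Fin d) (x : Fin d → ℕ)
    (hx : x ∉ Fintype.piFinset fun j => Finset.range (N j + 1)) : offspringMass N p i x = 0 := by
  simp only [Fintype.mem_piFinset, Finset.mem_range_succ_iff, not_forall] at hx
  obtain ⟨j, hj⟩ := hx
  refine Finset.prod_eq_zero (Finset.mem_univ j) ?_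
  rw [if_neg hj, if_neg (show x j ≠ 0 by omega), ite_self]

lemma offspringMass_mgf_le {d : ℕ} (N : Fin d → ℕ) (p : ℝ) (hp0 : 0 ≤ p) (hp1 : p ≤ 1)
    (i : Fin d) (s : Fin d → ℝ) (hs : ∀ j, |s j| ≤ 1) :
    ∑' x, offspringMass N p i x * Real.exp (∑ j, s j * x j) ≤
      Real.exp (∑ j, if j = i then 0 else N j * p * (s j + s j ^ 2)) := by
  rw [tsum_eq_sum (s := Fintype.piFinset fun j => Finset.range (N j + 1)) fun x hx => by
    rw [offspringMass_eq_zero N p i x hx, zero_mul]]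
  simp only [offspringMass, Real.exp_sum, ← Finset.prod_mul_distrib]
  rw [← Finset.prod_univ_sum (fun j => Finset.range (N j + 1)) fun j k =>
    (if j = i then (if k = 0 then (1 : ℝ) else 0)
      else (if k ≤ N j then ((N j).choose k : ℝ) * p ^ k * (1 - p) ^ (N j - k) else 0))
      * Real.exp (s j * k)]
  refine Finset.prod_le_prod (fun j _ => Finset.sum_nonneg fun k _ => ?_) fun j _ => ?_
  · have : 0 ≤ 1 - p := by linarith
    positivity
  · by_cases hj : j = i
    · simp [hj]
    · simp only [if_neg hj]
      refine (binomial_mgf_le (N j) p (s j) hp0 hp1).trans (Real.exp_le_exp.2 ?_)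
      exact mul_le_mul_of_nonneg_left (exp_sub_one_le _ (hs j)) (by positivity)

lemma exists_chernoff_parameter (δ C : ℝ) (hδ : 0 < δ) (hC : 0 < C) :
    ∃ θ : ℝ, 0 < θ ∧ θ ≤ 1 ∧ C * θ ^ 2 ≤ θ * δ / 2 := by
  refine ⟨min 1 (δ / (2 * C)), by positivity, min_le_left _ _, ?_⟩
  have h1 : min 1 (δ / (2 * C)) ≤ δ / (2 * C) := min_le_right _ _
  have h0 : 0 < min 1 (δ / (2 * C)) := by positivity
  rw [le_div_iff₀ (by positivity)] at h1
  nlinarith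

/-- **Lemma 3.2.** Large deviation bounds for the supercritical branching
random walk whose type-`i` offspring law has independent `Binomial(a_j n, λ/n)` coordinates
for `j ≠ i` and `0` at coordinate `i`, when `M_λ μ = ρ μ` with `ρ > 1`, `μ > 0`,
`‖μ‖₁ = 1`. -/
theorem branching_rw_large_deviations (d : ℕ) (hd : 2 ≤ d) (a : Fin d → ℝ)
    (ha : ∀ i, 0 < a i) (lam : ℝ) (n : ℕ) (hlam : 0 < lam) (hlamn : lam < n)
    (N : Fin d → ℕ) (hN : ∀ j, (N j : ℝ) = a j * n)
    (ν : Fin d → PMF (Fin d → ℕ))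
    (hν : ∀ i x, (ν i x).toReal =
      ∏ j, if j = i then (if x j = 0 then (1 : ℝ) else 0)
        else (if x j ≤ N j then
            ((N j).choose (x j) : ℝ) * (lam / n) ^ (x j) * (1 - lam / n) ^ (N j - x j)
          else 0))
    (ρ : ℝ) (hρ : 1 < ρ) (μ : Fin d → ℝ) (hμpos : ∀ i, 0 < μ i)
    (hμ1 : ∑ i, μ i = 1)
    (hEig : (hamM d a lam).mulVec μ = ρ • μ) :
    (∀ x : ℝ, 1 < x → ∃ η₁ : ℝ, 0 < η₁ ∧
        ∀ (t : ℕ) (S₀ : Fin d → ℕ), S₀ ≠ 0 →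
          walkProb ν t S₀
              {w | x * (ρ - 1) * (⨆ i, μ i) * t ≤ ∑ j, μ j * ((w j : ℝ) - (S₀ j : ℝ))}
            ≤ Real.exp (-η₁ * t)) ∧
    (∀ y : ℝ, y < 1 → ∃ η₂ : ℝ, 0 < η₂ ∧
        ∀ (t : ℕ) (S₀ : Fin d → ℕ), S₀ ≠ 0 →
          walkProb ν t S₀
              {w | w ≠ 0 ∧
                ∑ j, μ j * ((w j : ℝ) - (S₀ j : ℝ)) ≤ y * (ρ - 1) * (⨅ i, μ i) * t}
            ≤ Real.exp (-η₂ * t)) := by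
  have hn : (0 : ℝ) < n := hlam.trans hlamn
  have hp0 : 0 ≤ lam / n := by positivity
  have hp1 : lam / n ≤ 1 := (div_le_one hn).2 hlamn.le
  have hνp : ∀ i x, (ν i x).toReal = offspringMass N (lam / n) i x := hν
  have hfin : ∀ i, (Function.support fun x => (ν i x).toReal).Finite := fun i =>
    (Fintype.piFinset fun j => Finset.range (N j + 1)).finite_toSet.subset fun x hx => by
      by_contra h
      exact hx ((hνp i x).trans (offspringMass_eq_zero N _ i x h))
  have hμle : ∀ j, μ j ≤ 1 := fun j =>
    hμ1 ▸ Finset.single_le_sum (fun j _ => (hμpos j).le) (Finset.mem_univ j)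
  have hEig' : ∀ i, ∑ j, (if j = i then 0 else lam * a j * μ j) = ρ * μ i := fun i => by
    have := congrFun hEig i
    simp only [Matrix.mulVec, dotProduct, hamM, Matrix.of_apply, Pi.smul_apply,
      smul_eq_mul] at this
    rw [← this]
    refine Finset.sum_congr rfl fun j _ => ?_
    by_cases hj : j = i
    · simp [hj]
    · simp [hj, Ne.symm hj]
  have hd0 : Nonempty (Fin d) := ⟨⟨0, by omega⟩⟩
  set C : ℝ := ∑ j, lam * a j * μ j ^ 2 with hC
  have hCpos : 0 < C := Finset.sum_pos
    (fun j _ => by have := ha j; have := hμpos j; positivity) Finset.univ_nonempty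
  have hmgf : ∀ (i : Fin d) (s : ℝ), |s| ≤ 1 →
      ∑' x : Fin d → ℕ, (ν i x).toReal * Real.exp (s * ∑ j, μ j * x j) ≤
        Real.exp (s * (ρ * μ i) + C * s ^ 2) := by
    intro i s hs
    have h := offspringMass_mgf_le N (lam / n) hp0 hp1 i (fun j => s * μ j) fun j => by
      rw [abs_mul, abs_of_pos (hμpos j)]
      exact mul_le_one₀ hs (hμpos j).le (hμle j)
    simp only [hνp, Finset.mul_sum, ← mul_assoc]
    refine h.trans (Real.exp_le_exp.2 ?_)
    rw [mul_assoc, ← hEig' i, hC, Finset.mul_sum, Finset.sum_mul, ← Finset.sum_add_distrib]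
    refine Finset.sum_le_sum fun j _ => ?_
    have hNp : N j * (lam / n) = lam * a j := by rw [hN]; field_simp
    have := ha j
    rw [hNp]
    split_ifs
    · rw [mul_zero, zero_add]
      positivity
    · exact le_of_eq (by ring)
  have hstep : ∀ (s m : ℝ) (f : (Fin d → ℕ) → ℝ), |s| ≤ 1 → (∀ i, s * μ i ≤ s * m) →
      (∀ w, f w ≤ Real.exp (s * ∑ j, μ j * w j)) → ∀ u : Fin d → ℕ, u ≠ 0 →
      ∑' w, stepMass ν u w * f w ≤
        Real.exp (s * (ρ - 1) * m + C * s ^ 2) * Real.exp (s * ∑ j, μ j * u j) := by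
    intro s m f hs hm hf u hu
    refine stepMass_tsum_le ν hfin f u hu _ fun i hi => ?_
    have hval : ∀ x : Fin d → ℕ,
        ∑ j, μ j * ((u j + x j - if j = i then 1 else 0 : ℕ) : ℝ) =
          ∑ j, μ j * u j + ∑ j, μ j * x j - μ i := by
      intro x
      have : μ i = ∑ j, if j = i then μ j else 0 := by simp
      rw [this, ← Finset.sum_add_distrib, ← Finset.sum_sub_distrib]
      refine Finset.sum_congr rfl fun j _ => ?_
      split_ifs with hj
      · subst hj
        rw [Nat.cast_sub (by omega)]
        push_cast; ring
      · rw [Nat.sub_zero]; push_cast; ring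
    have hbd : ∀ x : Fin d → ℕ,
        (ν i x).toReal * f (fun j => u j + x j - if j = i then 1 else 0) ≤
        Real.exp (s * (∑ j, μ j * u j - μ i)) *
          ((ν i x).toReal * Real.exp (s * ∑ j, μ j * x j)) := by
      intro x
      calc _ ≤ (ν i x).toReal * Real.exp (s * (∑ j, μ j * u j + ∑ j, μ j * x j - μ i)) := by
            refine mul_le_mul_of_nonneg_left ((hf _).trans_eq ?_) ENNReal.toReal_nonneg
            rw [hval]
        _ = _ := by
            rw [show s * (∑ j, μ j * u j + ∑ j, μ j * x j - μ i) =
              s * (∑ j, μ j * u j - μ i) + s * ∑ j, μ j * x j by ring, Real.exp_add]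
            ring
    refine (Summable.tsum_le_tsum hbd (summable_mul_of_support_finite (hfin i) _)
      ((summable_mul_of_support_finite (hfin i) _).mul_left _)).trans ?_
    rw [tsum_mul_left]
    refine (mul_le_mul_of_nonneg_left (hmgf i s hs) (Real.exp_pos _).le).trans ?_
    rw [← Real.exp_add, ← Real.exp_add]
    refine Real.exp_le_exp.2 ?_
    nlinarith [mul_le_mul_of_nonneg_left (hm i) (sub_pos.2 hρ).le]
  constructor
  · intro x hx
    set m := ⨆ i, μ i
    have hm : ∀ i, μ i ≤ m := le_ciSup (Set.finite_range μ).bddAbove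
    have hmpos : 0 < m := (hμpos hd0.some).trans_le (hm _)
    have hδ : 0 < (x - 1) * ((ρ - 1) * m) :=
      mul_pos (sub_pos.2 hx) (mul_pos (sub_pos.2 hρ) hmpos)
    obtain ⟨θ, hθ0, hθ1, hθ⟩ := exists_chernoff_parameter _ C hδ hCpos
    refine ⟨θ * ((x - 1) * ((ρ - 1) * m)) / 2, by positivity, fun t S₀ _ => ?_⟩
    refine (walkProb_le ν hfin (fun w => Real.exp (θ * ∑ j, μ j * w j))
      (fun w => (Real.exp_pos _).le) (Real.exp (θ * (ρ - 1) * m + C * θ ^ 2)) (Real.exp_pos _).le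
      (fun u => ?_) t S₀ _ (Real.exp (θ * (x * (ρ - 1) * m * t + ∑ j, μ j * S₀ j)))
      (Real.exp_pos _) fun w hw => ?_).trans ?_
    · by_cases hu : u = 0
      · rw [tsum_eq_single u fun w hw => by simp [stepMass, hu, hu ▸ hw]]
        have : 0 < ρ - 1 := sub_pos.2 hρ
        have h1 : 1 ≤ Real.exp (θ * (ρ - 1) * m + C * θ ^ 2) := Real.one_le_exp (by positivity)
        simpa [stepMass, hu] using h1
      · exact hstep θ m _ (by rwa [abs_of_pos hθ0])
          (fun i => mul_le_mul_of_nonneg_left (hm i) hθ0.le) (fun w => le_rfl) u hu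
    · refine Real.exp_le_exp.2 (mul_le_mul_of_nonneg_left ?_ hθ0.le)
      simp only [Set.mem_ofPred_eq, mul_sub, Finset.sum_sub_distrib] at hw
      linarith
    · rw [← Real.exp_nat_mul, ← Real.exp_add, ← Real.exp_sub]
      refine Real.exp_le_exp.2 ?_
      have := mul_le_mul_of_nonneg_left hθ (Nat.cast_nonneg (α := ℝ) t)
      linarith
  · intro y hy
    set m := ⨅ i, μ i
    have hm : ∀ i, m ≤ μ i := ciInf_le (Set.finite_range μ).bddBelow
    have hmpos : 0 < m := by
      obtain ⟨i, hi⟩ := exists_eq_ciInf_of_finite (f := μ)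
      exact (hμpos i).trans_eq hi
    have hδ : 0 < (1 - y) * ((ρ - 1) * m) :=
      mul_pos (sub_pos.2 hy) (mul_pos (sub_pos.2 hρ) hmpos)
    obtain ⟨θ, hθ0, hθ1, hθ⟩ := exists_chernoff_parameter _ C hδ hCpos
    refine ⟨θ * ((1 - y) * ((ρ - 1) * m)) / 2, by positivity, fun t S₀ hS₀ => ?_⟩
    refine (walkProb_le ν hfin (fun w => if w = 0 then 0 else Real.exp (-θ * ∑ j, μ j * w j))
      (fun w => by split_ifs <;> positivity) (Real.exp (-θ * (ρ - 1) * m + C * (-θ) ^ 2))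
      (Real.exp_pos _).le
      (fun u => ?_) t S₀ _ (Real.exp (-θ * (y * (ρ - 1) * m * t + ∑ j, μ j * S₀ j)))
      (Real.exp_pos _) fun w hw => ?_).trans ?_
    · by_cases hu : u = 0
      · rw [tsum_eq_single u fun w hw => by simp [stepMass, hu, hu ▸ hw]]
        simp [hu]
      · simp only [if_neg hu]
        exact hstep (-θ) m _ (by rwa [abs_neg, abs_of_pos hθ0])
          (fun i => by nlinarith [hm i]) (fun w => by split_ifs <;> [positivity; exact le_rfl]) u hu
    · rw [if_neg hw.1]
      refine Real.exp_le_exp.2 ?_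
      have hw2 := hw.2
      simp only [mul_sub, Finset.sum_sub_distrib] at hw2
      nlinarith
    · rw [if_neg hS₀, ← Real.exp_nat_mul, ← Real.exp_add, ← Real.exp_sub]
      refine Real.exp_le_exp.2 ?_
      have := mul_le_mul_of_nonneg_left hθ (Nat.cast_nonneg (α := ℝ) t)
      linarith
end
end
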